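/- arXiv:2507.20981 — 5 statements merged into one kernel-verified Lean document; each statement's English description precedes it below -/
import Mathlib

section
/- Let U be a real Hilbert space, J : U → ℝ Fréchet differentiable with gradient ∇J and α-strongly convex for some α > 0, and let u* ∈ U satisfy ∇J(u*) = 0. Let (Ω, P) be a probability space, u ∈ U, τ ≥ 0, and let G : Ω → U be Bochner integrable with ∫ G dP = ∇J(u) and ∫ ‖G‖² dP < ∞. Then ∫ ‖u − τ·G(ω) − u*‖² dP(ω) ≤ (1 − 2τα)·‖u − u*‖² + τ²·∫ ‖G(ω)‖² dP(ω). -/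
open scoped RealInnerProductSpace
open MeasureTheory

/-- Strong convexity, stated as a first-order lower bound on `J` with slope field `g`, makes `g`
strongly monotone. -/
theorem strongly_monotone_of_strongly_convex
    {U : Type*} [NormedAddCommGroup U] [InnerProductSpace ℝ U]
    {J : U → ℝ} {g : U → U} {α : ℝ}
    (hsc : ∀ u u' : U, J u ≥ J u' + ⟪g u', u - u'⟫ + (α / 2) * ‖u - u'‖ ^ 2) (u v : U) :
    α * ‖u - v‖ ^ 2 ≤ ⟪g u - g v, u - v⟫ := by
  have huv := hsc u v
  have hvu := hsc v u
  rw [← neg_sub u v, inner_neg_right, norm_neg] at hvu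
  rw [inner_sub_left]
  linarith

/-- Second moment of a scaled random perturbation of a fixed vector. -/
theorem integral_norm_sub_smul_sq
    {U : Type*} [NormedAddCommGroup U] [InnerProductSpace ℝ U] [CompleteSpace U]
    {Ω : Type*} [MeasurableSpace Ω] {P : Measure Ω} [IsProbabilityMeasure P]
    {G : Ω → U} (hG : Integrable G P) (hG2 : Integrable (fun ω => ‖G ω‖ ^ 2) P)
    (x : U) (τ : ℝ) :
    ∫ ω, ‖x - τ • G ω‖ ^ 2 ∂P =
      ‖x‖ ^ 2 - 2 * τ * ⟪x, ∫ ω, G ω ∂P⟫ + τ ^ 2 * ∫ ω, ‖G ω‖ ^ 2 ∂P := by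
  have hinner : Integrable (fun ω => 2 * τ * ⟪x, G ω⟫) P := (hG.const_inner x).const_mul _
  have hexpand : ∀ ω, ‖x - τ • G ω‖ ^ 2 =
      ‖x‖ ^ 2 - 2 * τ * ⟪x, G ω⟫ + τ ^ 2 * ‖G ω‖ ^ 2 := fun ω => by
    rw [norm_sub_sq_real, real_inner_smul_right, norm_smul, mul_pow, Real.norm_eq_abs, sq_abs]
    ring
  have hsub : Integrable (fun ω => ‖x‖ ^ 2 - 2 * τ * ⟪x, G ω⟫) P :=
    (integrable_const _).sub hinner
  simp_rw [hexpand]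
  rw [integral_add hsub (hG2.const_mul _),
    integral_sub (integrable_const _) hinner, integral_const_mul, integral_const_mul,
    integral_inner hG]
  simp

/-- One-step mean-square contraction estimate for a stochastic gradient
step with an unbiased gradient estimator, under `α`-strong convexity of `J`. -/
theorem sgd_one_step_mean_square_contraction
    {U : Type*} [NormedAddCommGroup U] [InnerProductSpace ℝ U] [CompleteSpace U]
    (J : U → ℝ) (gradJ : U → U) (α : ℝ) (hα : 0 < α)
    (hdiff : ∀ u, HasGradientAt J (gradJ u) u)
    (hsc : ∀ u u' : U,
      J u ≥ J u' + ⟪gradJ u', u - u'⟫ + (α / 2) * ‖u - u'‖ ^ 2)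
    (uStar : U) (hcrit : gradJ uStar = 0)
    {Ω : Type*} [MeasurableSpace Ω] (P : Measure Ω) [IsProbabilityMeasure P]
    (u : U) (τ : ℝ) (hτ : 0 ≤ τ)
    (G : Ω → U) (hG : Integrable G P)
    (hmean : ∫ ω, G ω ∂P = gradJ u)
    (hG2 : Integrable (fun ω => ‖G ω‖ ^ 2) P) :
    ∫ ω, ‖u - τ • G ω - uStar‖ ^ 2 ∂P ≤
      (1 - 2 * τ * α) * ‖u - uStar‖ ^ 2 + τ ^ 2 * ∫ ω, ‖G ω‖ ^ 2 ∂P := by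
  have hmono := strongly_monotone_of_strongly_convex hsc u uStar
  rw [hcrit, sub_zero, real_inner_comm] at hmono
  simp_rw [sub_right_comm u _ uStar]
  rw [integral_norm_sub_smul_sq hG hG2, hmean]
  linarith [mul_le_mul_of_nonneg_left hmono hτ]
end

section
/- Let a ∈ ℝ, b > 0 and let s ∈ ℕ with s ≥ 1. If a + s·b < 1, then there exists x ∈ (0,1) such that x^s·(−x² + (1+a)·x + b − a) > b. -/
/-- If `a + s·b < 1` with `b > 0` and `s ≥ 1`, then the polynomial
`x ↦ x^s (−x² + (1+a)x + b − a)` exceeds `b` somewhere in `(0,1)`. -/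
theorem polynomial_inequality_exists
    (a b : ℝ) (s : ℕ) (hb : 0 < b) (hs : 1 ≤ s) (hab : a + s * b < 1) :
    ∃ x ∈ Set.Ioo (0 : ℝ) 1, x ^ s * (-x ^ 2 + (1 + a) * x + b - a) > b := by
  let g : ℝ → ℝ := fun x => x ^ s * (x - a) - b * ∑ i ∈ Finset.range s, x ^ i
  have hg : Continuous g := by fun_prop
  have hg_one : 0 < g 1 := by
    simp only [g, one_pow, Finset.sum_const, Finset.card_range, nsmul_eq_mul]
    linarith
  have hpos : ∀ᶠ x in nhdsWithin (1 : ℝ) (Set.Iio 1), 0 < g x :=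
    (hg.continuousAt.eventually_const_lt hg_one).filter_mono nhdsWithin_le_nhds
  obtain ⟨x, hgx, hx⟩ := (hpos.and (Ioo_mem_nhdsLT (zero_lt_one (α := ℝ)))).exists
  refine ⟨x, hx, ?_⟩
  have hfactor : x ^ s * (-x ^ 2 + (1 + a) * x + b - a) - b = (1 - x) * g x := by
    linear_combination (-b) * geom_sum_mul x s
  have hprod : 0 < (1 - x) * g x := mul_pos (sub_pos.mpr hx.2) hgx
  linarith
end

section
/- Let a > 0. Let f be continuously differentiable on [a, ∞) with f(x) > 0 for all x ≥ a, and let φ be twice continuously differentiable on [a, ∞) with φ'(x) > 0 for all x ≥ a. Assume there exist constants C, C', ξ, η > 0 and δ > −1 such that for all x ≥ a: (1/C)·x^{−ξ} ≤ f(x)/φ'(x) ≤ C·(1 + x^η) and φ'(x) ≥ C'·x^δ, and assume that R(x) := (f'(x)·φ'(x) − f(x)·φ''(x)) / (f(x)·φ'(x)²) tends to 0 as x → ∞. Then ∫_a^k f(x)·e^{φ(x)} dx is asymptotically equivalent, as k → ∞, to (f(k)/φ'(k))·e^{φ(k)}; that is, the ratio of the two quantities tends to 1. -/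
open Filter MeasureTheory

/-- If `u'` is negligible with respect to `v'`, where `v' ≥ 0` and `v → ∞`, then `u` is negligible
with respect to `v`. -/
theorem isLittleO_of_hasDerivAt_isLittleO {u u' v v' : ℝ → ℝ}
    (hu : ∀ᶠ x in atTop, HasDerivAt u (u' x) x) (hv : ∀ᶠ x in atTop, HasDerivAt v (v' x) x)
    (hv' : ∀ᶠ x in atTop, 0 ≤ v' x) (h : u' =o[atTop] v') (hlim : Tendsto v atTop atTop) :
    u =o[atTop] v := by
  rw [Asymptotics.isLittleO_iff]
  intro ε hε
  obtain ⟨N, hN⟩ := eventually_atTop.1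
    (((hu.and hv).and hv').and (h.bound (half_pos hε)))
  have hbound : ∀ x ∈ Set.Ici N, |u' x| ≤ ε / 2 * v' x := fun x hx ↦ by
    simpa [abs_of_nonneg (hN x hx).1.2] using (hN x hx).2
  have hmono (w w' : ℝ → ℝ) (hw : ∀ x ∈ Set.Ici N, HasDerivAt w (w' x) x)
      (hw' : ∀ x ∈ Set.Ici N, 0 ≤ w' x) : MonotoneOn w (Set.Ici N) :=
    monotoneOn_of_hasDerivWithinAt_nonneg (convex_Ici N)
      (fun x hx ↦ (hw x hx).continuousAt.continuousWithinAt)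
      (fun x hx ↦ (hw x (interior_subset hx)).hasDerivWithinAt)
      (fun x hx ↦ hw' x (interior_subset hx))
  have h₁ := hmono (fun x ↦ ε / 2 * v x - u x) (fun x ↦ ε / 2 * v' x - u' x)
    (fun x hx ↦ ((hN x hx).1.1.2.const_mul _).sub (hN x hx).1.1.1)
    (fun x hx ↦ by linarith [(abs_le.1 (hbound x hx)).2])
  have h₂ := hmono (fun x ↦ ε / 2 * v x + u x) (fun x ↦ ε / 2 * v' x + u' x)
    (fun x hx ↦ ((hN x hx).1.1.2.const_mul _).add (hN x hx).1.1.1)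
    (fun x hx ↦ by linarith [(abs_le.1 (hbound x hx)).1])
  filter_upwards [eventually_ge_atTop N, hlim.eventually_ge_atTop 0,
    (hlim.const_mul_atTop (half_pos hε)).eventually_ge_atTop (|u N| + ε / 2 * |v N|)]
    with x hx hx0 hxl
  have e₁ := h₁ Set.self_mem_Ici hx hx
  have e₂ := h₂ Set.self_mem_Ici hx hx
  have e₃ : ε / 2 * -|v N| ≤ ε / 2 * v N := by gcongr; exact neg_abs_le _
  rw [Real.norm_eq_abs, Real.norm_eq_abs, abs_of_nonneg hx0, abs_le]
  simp only at e₁ e₂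
  constructor <;> linarith [neg_abs_le (u N), le_abs_self (u N)]

/-- If `φ' ≥ c x ^ (p - 1)` with `c, p > 0`, then `e ^ φ` outgrows every power of `x`. -/
theorem tendsto_rpow_neg_mul_exp_atTop {φ φ' : ℝ → ℝ} {a c p : ℝ} (ha : 0 < a) (hc : 0 < c)
    (hp : 0 < p) (hφ : ∀ x ∈ Set.Ici a, HasDerivAt φ (φ' x) x)
    (hφ' : ∀ x ∈ Set.Ici a, c * x ^ (p - 1) ≤ φ' x) (s : ℝ) :
    Tendsto (fun x ↦ x ^ (-s) * Real.exp (φ x)) atTop atTop := by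
  have hder : ∀ x ∈ Set.Ici a,
      HasDerivAt (fun x ↦ φ x - c / p * x ^ p) (φ' x - c / p * (p * x ^ (p - 1))) x :=
    fun x hx ↦ (hφ x hx).sub
      ((Real.hasDerivAt_rpow_const (Or.inl (ha.trans_le hx).ne')).const_mul _)
  have hmono : MonotoneOn (fun x ↦ φ x - c / p * x ^ p) (Set.Ici a) :=
    monotoneOn_of_hasDerivWithinAt_nonneg (convex_Ici a)
      (fun x hx ↦ (hder x hx).continuousAt.continuousWithinAt)
      (fun x hx ↦ (hder x (interior_subset hx)).hasDerivWithinAt)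
      (fun x hx ↦ by
        rw [← mul_assoc, div_mul_cancel₀ _ hp.ne', sub_nonneg]
        exact hφ' x (interior_subset hx))
  have hlim := ((tendsto_exp_mul_div_rpow_atTop (s / p) (c / p) (div_pos hc hp)).comp
    (tendsto_rpow_atTop hp)).const_mul_atTop (Real.exp_pos (φ a - c / p * a ^ p))
  refine tendsto_atTop_mono' _ ?_ hlim
  filter_upwards [eventually_ge_atTop a] with x hx
  have hx0 : 0 < x := ha.trans_le hx
  have hle := hmono Set.self_mem_Ici hx hx
  simp only at hle
  rw [Function.comp_apply, ← Real.rpow_mul hx0.le, mul_div_cancel₀ _ hp.ne', ← mul_div_assoc,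
    ← Real.exp_add, Real.rpow_neg hx0.le, inv_mul_eq_div]
  gcongr
  linarith

/-- Endpoint asymptotics for exponential integrals:
under the stated growth and regularity conditions,
`∫_a^k f(x) e^{φ(x)} dx ∼ (f(k)/φ'(k)) e^{φ(k)}` as `k → ∞`. -/
theorem endpoint_asymptotics_exponential_integral
    (a : ℝ) (ha : 0 < a)
    (f f' φ φ' φ'' : ℝ → ℝ)
    (hf : ∀ x ∈ Set.Ici a, HasDerivAt f (f' x) x)
    (hf'cont : ContinuousOn f' (Set.Ici a))
    (hfpos : ∀ x ∈ Set.Ici a, 0 < f x)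
    (hφ : ∀ x ∈ Set.Ici a, HasDerivAt φ (φ' x) x)
    (hφ' : ∀ x ∈ Set.Ici a, HasDerivAt φ' (φ'' x) x)
    (hφ''cont : ContinuousOn φ'' (Set.Ici a))
    (hφ'pos : ∀ x ∈ Set.Ici a, 0 < φ' x)
    (C C' ξ η δ : ℝ) (hC : 0 < C) (hC' : 0 < C')
    (hξ : 0 < ξ) (hη : 0 < η) (hδ : -1 < δ)
    (hlow : ∀ x ∈ Set.Ici a, (1 / C) * x ^ (-ξ) ≤ f x / φ' x)
    (hup : ∀ x ∈ Set.Ici a, f x / φ' x ≤ C * (1 + x ^ η))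
    (hφ'low : ∀ x ∈ Set.Ici a, C' * x ^ δ ≤ φ' x)
    (hR : Tendsto (fun x => (f' x * φ' x - f x * φ'' x) / (f x * (φ' x) ^ 2))
      atTop (nhds 0)) :
    Tendsto (fun k => (∫ x in a..k, f x * Real.exp (φ x)) /
        ((f k / φ' k) * Real.exp (φ k))) atTop (nhds 1) := by
  have hgrow : Tendsto (fun x ↦ f x / φ' x * Real.exp (φ x)) atTop atTop := by
    refine tendsto_atTop_mono' _ ?_ ((tendsto_rpow_neg_mul_exp_atTop (p := δ + 1) ha hC'
      (by linarith) hφ (by simpa using hφ'low) ξ).const_mul_atTop (one_div_pos.2 hC))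
    filter_upwards [eventually_ge_atTop a] with x hx
    rw [← mul_assoc]
    gcongr
    exact hlow x hx
  set R : ℝ → ℝ := fun x ↦ (f' x * φ' x - f x * φ'' x) / (f x * (φ' x) ^ 2) with hRdef
  have hGder : ∀ x ∈ Set.Ici a, HasDerivAt (fun x ↦ f x / φ' x * Real.exp (φ x))
      (f x * Real.exp (φ x) * (1 + R x)) x := fun x hx ↦ by
    have hf0 := (hfpos x hx).ne'
    have hφ0 := (hφ'pos x hx).ne'
    refine (((hf x hx).div (hφ' x hx) hφ0).mul (hφ x hx).exp).congr_deriv ?_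
    simp only [hRdef, Pi.div_apply]
    field_simp
    ring
  have hcont : ContinuousOn (fun x ↦ f x * Real.exp (φ x)) (Set.Ici a) := fun x hx ↦
    ((hf x hx).continuousAt.mul (hφ x hx).exp.continuousAt).continuousWithinAt
  have hIder : ∀ x ∈ Set.Ioi a,
      HasDerivAt (fun k ↦ ∫ x in a..k, f x * Real.exp (φ x)) (f x * Real.exp (φ x)) x :=
    fun x hx ↦ by
      refine intervalIntegral.integral_hasDerivAt_right
        ((hcont.mono ?_).intervalIntegrable)
        ((hcont.mono Set.Ioi_subset_Ici_self).stronglyMeasurableAtFilter isOpen_Ioi x hx)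
        (hcont.continuousAt (Ici_mem_nhds hx))
      rw [Set.uIcc_of_le (Set.mem_Ioi.1 hx).le]
      exact Set.Icc_subset_Ici_self
  have hR1 : ∀ᶠ x in atTop, 1 / 2 < 1 + R x := by
    filter_upwards [hR.eventually_const_lt (show (-1 / 2 : ℝ) < 0 by norm_num)] with x hx
    linarith
  have hquot : Tendsto (fun x ↦ -R x / (1 + R x)) atTop (nhds 0) := by
    have h := hR.neg.div (hR.const_add 1) (by norm_num)
    rwa [neg_zero, zero_div] at h
  have hdiff := isLittleO_of_hasDerivAt_isLittleO
    (u := fun k ↦ (∫ x in a..k, f x * Real.exp (φ x)) - f k / φ' k * Real.exp (φ k))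
    ((eventually_gt_atTop a).mono fun x hx ↦ (hIder x hx).sub (hGder x (le_of_lt hx)))
    ((eventually_ge_atTop a).mono hGder)
    (by
      filter_upwards [eventually_ge_atTop a, hR1] with x hx hx1
      have := hfpos x hx
      have : 0 < 1 + R x := by linarith
      positivity)
    (by
      refine Asymptotics.isLittleO_iff_exists_eq_mul.2 ⟨_, hquot, ?_⟩
      filter_upwards [hR1] with x hx
      have : 1 + R x ≠ 0 := by linarith
      simp only [Pi.mul_apply]
      field_simp
      ring)
    hgrow
  refine (Asymptotics.isEquivalent_iff_tendsto_one ?_).1 hdiff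
  exact (hgrow.eventually_gt_atTop 0).mono fun x hx ↦ hx.ne'
end

section
/- Let a > 0, α ∈ ℝ and β > 0. Then ∫_a^k x^α·e^{x^β} dx is asymptotically equivalent, as k → ∞, to (1/β)·k^{α−β+1}·e^{k^β}; that is, the ratio of the two quantities tends to 1 as k → ∞. -/
open Filter MeasureTheory

/-- An `∞ / ∞` form of L'Hôpital's rule: if `f' = o(g')` at infinity, `g'` is eventually
nonnegative and `g` tends to infinity, then `f = o(g)`. -/
theorem isLittleO_atTop_of_hasDerivAt {E : Type*} [NormedAddCommGroup E] [NormedSpace ℝ E]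
    {f f' : ℝ → E} {g g' : ℝ → ℝ}
    (hf : ∀ᶠ x in atTop, HasDerivAt f (f' x) x) (hg : ∀ᶠ x in atTop, HasDerivAt g (g' x) x)
    (hg' : ∀ᶠ x in atTop, 0 ≤ g' x) (hfg : f' =o[atTop] g') (hgtop : Tendsto g atTop atTop) :
    f =o[atTop] g := by
  rw [Asymptotics.isLittleO_iff]
  intro c hc
  obtain ⟨M, hM⟩ := eventually_atTop.1
    (hf.and (hg.and (hg'.and (hfg.bound (half_pos hc)))))
  have key : ∀ x, M ≤ x → ‖f x‖ ≤ ‖f M‖ + c / 2 * (g x - g M) := by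
    intro x hx
    refine image_norm_le_of_norm_deriv_right_le_deriv_boundary' (a := M) (b := x) (f' := f')
      (B := fun y => ‖f M‖ + c / 2 * (g y - g M)) (B' := fun y => c / 2 * g' y)
      (fun y hy => (hM y hy.1).1.continuousAt.continuousWithinAt)
      (fun y hy => (hM y hy.1).1.hasDerivWithinAt) (by simp) ?_ ?_ ?_ ⟨hx, le_rfl⟩
    · intro y hy
      have := (hM y hy.1).2.1.continuousAt
      exact ContinuousAt.continuousWithinAt (by fun_prop)
    · intro y hy
      exact ((((hM y hy.1).2.1.sub_const _).const_mul _).const_add _).hasDerivWithinAt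
    · intro y hy
      obtain ⟨-, -, h0, hb⟩ := hM y hy.1
      rwa [Real.norm_of_nonneg h0] at hb
  filter_upwards [eventually_ge_atTop M, hgtop.eventually_ge_atTop 0,
    (hgtop.const_mul_atTop (half_pos hc)).eventually_ge_atTop (‖f M‖ - c / 2 * g M)]
    with x hx h0 hlarge
  rw [Real.norm_of_nonneg h0]
  linarith [key x hx]

theorem tendsto_rpow_mul_exp_rpow_atTop (s : ℝ) {β : ℝ} (hβ : 0 < β) :
    Tendsto (fun k : ℝ => k ^ s * Real.exp (k ^ β)) atTop atTop := by
  refine ((tendsto_exp_div_rpow_atTop (-s / β)).comp (tendsto_rpow_atTop hβ)).congr' ?_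
  filter_upwards [eventually_gt_atTop 0] with k hk
  rw [Function.comp_apply, ← Real.rpow_mul hk.le, mul_div_cancel₀ _ hβ.ne', Real.rpow_neg hk.le,
    div_inv_eq_mul, mul_comm]

theorem hasDerivAt_rpow_mul_exp_rpow (α : ℝ) {β k : ℝ} (hβ : 0 < β) (hk : 0 < k) :
    HasDerivAt (fun k : ℝ => (1 / β) * k ^ (α - β + 1) * Real.exp (k ^ β))
      (k ^ α * Real.exp (k ^ β) * ((α - β + 1) / β * k ^ (-β) + 1)) k := by
  have h := ((Real.hasDerivAt_rpow_const (p := α - β + 1) (Or.inl hk.ne')).const_mul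
    (1 / β)).mul (Real.hasDerivAt_rpow_const (p := β) (Or.inl hk.ne')).exp
  refine h.congr_deriv ?_
  have h1 : k ^ (α - β + 1 - 1) = k ^ α * k ^ (-β) := by
    rw [← Real.rpow_add hk]; ring_nf
  have h2 : k ^ (α - β + 1) * k ^ (β - 1) = k ^ α := by
    rw [← Real.rpow_add hk]; ring_nf
  rw [h1, ← h2]
  field_simp

theorem hasDerivAt_integral_rpow_mul_exp_rpow (α β : ℝ) {a k : ℝ} (ha : 0 < a) (hk : 0 < k) :
    HasDerivAt (fun k : ℝ => ∫ x in a..k, x ^ α * Real.exp (x ^ β))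
      (k ^ α * Real.exp (k ^ β)) k := by
  have hc : ContinuousOn (fun x : ℝ => x ^ α * Real.exp (x ^ β)) (Set.Ioi 0) := fun x hx =>
    ((Real.continuousAt_rpow_const x α (Or.inl (ne_of_gt hx))).mul
      (Real.continuousAt_rpow_const x β (Or.inl (ne_of_gt hx))).rexp).continuousWithinAt
  refine intervalIntegral.integral_hasDerivAt_right
    (hc.mono fun x hx => (lt_min ha hk).trans_le hx.1).intervalIntegrable
    (hc.stronglyMeasurableAtFilter isOpen_Ioi k hk) (hc.continuousAt (Ioi_mem_nhds hk))

/-- For `a > 0`, `α ∈ ℝ`, `β > 0`,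
`∫_a^k x^α e^{x^β} dx ∼ (1/β) k^{α−β+1} e^{k^β}` as `k → ∞`. -/
theorem integral_rpow_exp_rpow_asymptotics
    (a α β : ℝ) (ha : 0 < a) (hβ : 0 < β) :
    Tendsto (fun k : ℝ => (∫ x in a..k, x ^ α * Real.exp (x ^ β)) /
        ((1 / β) * k ^ (α - β + 1) * Real.exp (k ^ β))) atTop (nhds 1) := by
  have hr : Tendsto (fun k : ℝ => (α - β + 1) / β * k ^ (-β)) atTop (nhds 0) := by
    simpa using (tendsto_rpow_neg_atTop hβ).const_mul ((α - β + 1) / β)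
  have hr1 : (fun k : ℝ => (α - β + 1) / β * k ^ (-β)) =o[atTop] fun _ => (1 : ℝ) :=
    (Asymptotics.isLittleO_one_iff ℝ).2 hr
  have htop : Tendsto (fun k : ℝ => (1 / β) * k ^ (α - β + 1) * Real.exp (k ^ β)) atTop atTop := by
    simpa only [mul_assoc] using
      (tendsto_rpow_mul_exp_rpow_atTop (α - β + 1) hβ).const_mul_atTop (one_div_pos.2 hβ)
  refine (Asymptotics.isEquivalent_iff_tendsto_one
    (htop.eventually_ne_atTop 0)).1 (isLittleO_atTop_of_hasDerivAt
      (f' := fun k => k ^ α * Real.exp (k ^ β) * -((α - β + 1) / β * k ^ (-β)))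
      (g' := fun k => k ^ α * Real.exp (k ^ β) * ((α - β + 1) / β * k ^ (-β) + 1))
      ?_ ?_ ?_ ?_ htop)
  · filter_upwards [eventually_gt_atTop 0] with k hk
    exact ((hasDerivAt_integral_rpow_mul_exp_rpow α β ha hk).sub
      (hasDerivAt_rpow_mul_exp_rpow α hβ hk)).congr_deriv (by ring)
  · filter_upwards [eventually_gt_atTop 0] with k hk
    exact hasDerivAt_rpow_mul_exp_rpow α hβ hk
  · filter_upwards [eventually_gt_atTop 0, hr.eventually_const_le (neg_one_lt_zero)] with k hk h
    have : 0 ≤ (α - β + 1) / β * k ^ (-β) + 1 := by linarith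
    positivity
  · exact (Asymptotics.isBigO_refl _ _).mul_isLittleO
      (hr1.neg_left.trans_isBigO hr1.right_isBigO_add)
end

section
/- Let H be a real Hilbert space, B : H → H a bounded self-adjoint linear operator, z_d ∈ H and λ ∈ ℝ with B z_d = λ·z_d, and let α ∈ ℝ and β > 0. Define J̃(u) := (1/2)·‖B u + α·z_d‖² + (β/2)·‖u‖². Then u* := −( α·λ/(λ² + β) )·z_d is the unique global minimizer of J̃: J̃(u*) ≤ J̃(u) for all u ∈ H, with equality only for u = u*. -/
open scoped RealInnerProductSpace

/-- Expansion of `u ↦ ½‖Bu + w‖² + (β/2)‖u‖²` around a point `v` satisfying the Euler equation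
`⟪Bv + w, Bh⟫ + β⟪v, h⟫ = 0` for all `h`. -/
theorem quadratic_functional_eq_add {E F : Type*}
    [NormedAddCommGroup E] [InnerProductSpace ℝ E] [NormedAddCommGroup F] [InnerProductSpace ℝ F]
    (B : E →ₗ[ℝ] F) (w : F) (β : ℝ) (v : E)
    (hv : ∀ h : E, ⟪B v + w, B h⟫ + β * ⟪v, h⟫ = 0) (u : E) :
    (1 / 2) * ‖B u + w‖ ^ 2 + (β / 2) * ‖u‖ ^ 2
      = (1 / 2) * ‖B v + w‖ ^ 2 + (β / 2) * ‖v‖ ^ 2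
        + ((1 / 2) * ‖B (u - v)‖ ^ 2 + (β / 2) * ‖u - v‖ ^ 2) := by
  have hBu : B u + w = (B v + w) + B (u - v) := by rw [map_sub]; abel
  have hu : ‖u‖ ^ 2 = ‖v‖ ^ 2 + 2 * ⟪v, u - v⟫ + ‖u - v‖ ^ 2 := by
    rw [← norm_add_sq_real, add_sub_cancel]
  rw [hBu, norm_add_sq_real, hu]
  linear_combination hv (u - v)

/-- Let `H` be a real Hilbert space, `B : H → H` a bounded self-adjoint
operator, `z_d` an eigenvector of `B` with eigenvalue `λ`, and `β > 0`. Then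
`J̃(u) = ½‖Bu + α z_d‖² + (β/2)‖u‖²` has the unique global minimizer
`u* = −(αλ/(λ² + β)) z_d`. -/
theorem quadratic_functional_unique_minimizer
    {H : Type*} [NormedAddCommGroup H] [InnerProductSpace ℝ H] [CompleteSpace H]
    (B : H →L[ℝ] H) (hB : ∀ x y : H, ⟪B x, y⟫ = ⟪x, B y⟫)
    (zd : H) (lam α β : ℝ) (hβ : 0 < β) (hz : B zd = lam • zd) :
    (∀ u : H,
        (1 / 2) * ‖B ((-(α * lam / (lam ^ 2 + β))) • zd) + α • zd‖ ^ 2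
          + (β / 2) * ‖(-(α * lam / (lam ^ 2 + β))) • zd‖ ^ 2
        ≤ (1 / 2) * ‖B u + α • zd‖ ^ 2 + (β / 2) * ‖u‖ ^ 2) ∧
    (∀ u : H, u ≠ (-(α * lam / (lam ^ 2 + β))) • zd →
        (1 / 2) * ‖B ((-(α * lam / (lam ^ 2 + β))) • zd) + α • zd‖ ^ 2
          + (β / 2) * ‖(-(α * lam / (lam ^ 2 + β))) • zd‖ ^ 2
        < (1 / 2) * ‖B u + α • zd‖ ^ 2 + (β / 2) * ‖u‖ ^ 2) := by
  have hv (h : H) : ⟪B ((-(α * lam / (lam ^ 2 + β))) • zd) + α • zd, B h⟫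
      + β * ⟪(-(α * lam / (lam ^ 2 + β))) • zd, h⟫ = 0 := by
    have hpos : lam ^ 2 + β ≠ 0 := by positivity
    have hzh : ⟪zd, B h⟫ = lam * ⟪zd, h⟫ := by rw [← hB, hz, real_inner_smul_left]
    rw [map_smul, hz, inner_add_left]
    simp only [real_inner_smul_left, hzh]
    field_simp
    ring
  have key := quadratic_functional_eq_add B.toLinearMap (α • zd) β _ hv
  simp only [ContinuousLinearMap.coe_coe] at key
  refine ⟨fun u => ?_, fun u hu => ?_⟩
  · rw [key u]
    exact le_add_of_nonneg_right (by positivity)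
  · have hnorm := norm_pos_iff.mpr (sub_ne_zero.mpr hu)
    rw [key u]
    exact lt_add_of_pos_right _ (by positivity)
end
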